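/- Let d ≥ 1, m > 0, β ≥ 0, and let f(x) = η(x/|x|) e^{-m|x|}(max(1,|x|))^{-β} with η : S^{d-1} → [c₁, c₂], 0 < c₁ ≤ c₂. Define K_f(r) = sup_{|x|≥1} ∫_{|x-y|>r, |y|>r} f(x-y)f(y)/f(x) dy. Then for r > 1: K_f(r) = ∞ if 0 ≤ β ≤ (d+1)/2, and K_f(r) ≍ r^{(d+1)/2 − β} if β > (d+1)/2. -/

import Mathlib

open Filter MeasureTheory
open scoped ENNReal

/-- `K_f(r) = sup_{‖x‖ ≥ 1} ∫_{‖x-y‖ > r, ‖y‖ > r} f(x-y) f(y) / f(x) dy`,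
valued in `ℝ≥0∞`. -/
noncomputable def Kf (d : ℕ) (f : EuclideanSpace ℝ (Fin d) → ℝ) (r : ℝ) : ℝ≥0∞ :=
  ⨆ x : {x : EuclideanSpace ℝ (Fin d) // 1 ≤ ‖x‖},
    ∫⁻ y in {y : EuclideanSpace ℝ (Fin d) | r < ‖(x : EuclideanSpace ℝ (Fin d)) - y‖ ∧ r < ‖y‖},
      ENNReal.ofReal (f ((x : EuclideanSpace ℝ (Fin d)) - y) * f y / f (x : EuclideanSpace ℝ (Fin d)))

theorem gauss_bound (n : ℕ) (e : EuclideanSpace ℝ (Fin (n+1))) (he : ‖e‖ = 1) (m ρ : ℝ)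
    (hm : 0 < m) (hρ : 0 < ρ) :
    ∫⁻ y in {y : EuclideanSpace ℝ (Fin (n+1)) | ‖y‖ ≤ 2 * ρ},
      ENNReal.ofReal (Real.exp (-m * (‖y‖ - inner ℝ e y))) ≤
    ENNReal.ofReal (Real.exp 1 * (√(4 * Real.pi) * √(4 * Real.pi / m) ^ n) *
      ρ ^ ((((n + 1 : ℕ) : ℝ) + 1) / 2)) := by
  classical
  obtain ⟨b, hb⟩ := Orthonormal.exists_orthonormalBasis_extension_of_card_eq (𝕜 := ℝ)
    (E := EuclideanSpace ℝ (Fin (n+1))) (ι := Fin (n+1)) (by simp) (v := fun _ => e)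
    (s := {(0 : Fin (n+1))}) (by
      rw [orthonormal_iff_ite]
      rintro ⟨i, hi⟩ ⟨j, hj⟩
      simp at hi hj
      subst hi; subst hj
      simp [he])
  have hb0 : b 0 = e := hb 0 rfl
  let a : Fin (n+1) → ℝ := Fin.cons (1 / (4 * ρ ^ 2)) (fun _ => m / (4 * ρ))
  have ha : ∀ i, 0 < a i := by
    intro i
    refine Fin.cases ?_ ?_ i
    · simp only [a, Fin.cons_zero]; positivity
    · intro j; simp only [a, Fin.cons_succ]; positivity
  let g : (Fin (n+1) → ℝ) → ℝ := fun z => Real.exp 1 * ∏ i, Real.exp (-(a i) * (z i) ^ 2)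
  have hgpos : ∀ z, 0 ≤ g z := fun z => by positivity
  have hgint : Integrable g := by
    apply Integrable.const_mul
    exact Integrable.fintype_prod (f := fun i (x : ℝ) => Real.exp (-(a i) * x ^ 2))
      (fun i => integrable_exp_neg_mul_sq (ha i))
  have hgval : ∫ z, g z = Real.exp 1 * (√(4 * Real.pi) * √(4 * Real.pi / m) ^ n) *
      ρ ^ ((((n + 1 : ℕ) : ℝ) + 1) / 2) := by
    simp only [g]
    rw [integral_const_mul,
      integral_fintype_prod_volume_eq_prod (f := fun i (x : ℝ) => Real.exp (-(a i) * x ^ 2))]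
    simp_rw [integral_gaussian]
    rw [Fin.prod_univ_succ]
    simp only [a, Fin.cons_zero, Fin.cons_succ, Finset.prod_const, Finset.card_univ,
      Fintype.card_fin]
    have h1 : √(Real.pi / (1 / (4 * ρ ^ 2))) = √(4 * Real.pi) * ρ := by
      rw [show Real.pi / (1 / (4 * ρ ^ 2)) = (4 * Real.pi) * ρ ^ 2 by field_simp,
        Real.sqrt_mul (by positivity), Real.sqrt_sq hρ.le]
    have h2 : √(Real.pi / (m / (4 * ρ))) = √(4 * Real.pi / m) * √ρ := by
      rw [← Real.sqrt_mul (by positivity)]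
      congr 1
      field_simp
    have h3 : ρ ^ ((((n + 1 : ℕ) : ℝ) + 1) / 2) = ρ * √ρ ^ n := by
      rw [Real.sqrt_eq_rpow, ← Real.rpow_natCast, ← Real.rpow_mul hρ.le]
      nth_rewrite 2 [← Real.rpow_one ρ]
      rw [← Real.rpow_add hρ]
      congr 1
      push_cast
      ring
    rw [h1, h2, h3, mul_pow]
    ring
  have hgl : ∫⁻ z, ENNReal.ofReal (g z) = ENNReal.ofReal (∫ z, g z) :=
    (ofReal_integral_eq_lintegral_ofReal hgint (ae_of_all _ hgpos)).symm
  have hmp : MeasurePreserving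
      (fun y : EuclideanSpace ℝ (Fin (n+1)) => (WithLp.ofLp (b.repr y) : Fin (n+1) → ℝ)) :=
    (PiLp.volume_preserving_ofLp (Fin (n+1))).comp b.measurePreserving_repr
  have hgm : Measurable fun z => ENNReal.ofReal (g z) := by
    simp only [g]; fun_prop
  rw [← hgval, ← hgl, ← hmp.lintegral_comp hgm]
  refine (setLIntegral_mono' (measurableSet_le (by fun_prop) (by fun_prop)) ?_).trans
    (setLIntegral_le_lintegral _ _)
  intro y hy
  apply ENNReal.ofReal_le_ofReal
  simp only [Set.mem_ofPred_eq] at hy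
  simp only [g, ← Real.exp_sum, ← Real.exp_add]
  apply Real.exp_le_exp.mpr
  have hN := b.sum_sq_inner_right y
  rw [Fin.sum_univ_succ, hb0] at hN
  rw [Fin.sum_univ_succ]
  simp only [b.repr_apply_apply, hb0, a, Fin.cons_zero, Fin.cons_succ, ← Finset.mul_sum]
  set W := ∑ i : Fin n, inner ℝ (b i.succ) y ^ 2
  set s := inner ℝ e y
  have hs : |s| ≤ ‖y‖ := by
    have := abs_real_inner_le_norm e y
    rwa [he, one_mul] at this
  obtain ⟨hs1, hs2⟩ := abs_le.mp hs
  have h1 : s ^ 2 ≤ 4 * ρ ^ 2 := by nlinarith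
  have h2 : W / (4 * ρ) ≤ ‖y‖ - s := by
    rw [div_le_iff₀ (by positivity)]
    nlinarith [mul_le_mul_of_nonneg_left (show ‖y‖ + s ≤ 4 * ρ by linarith) (sub_nonneg.2 hs2)]
  have h3 : 1 / (4 * ρ ^ 2) * s ^ 2 ≤ 1 := by
    rw [one_div_mul_eq_div, div_le_one (by positivity)]; exact h1
  have h4 := mul_le_mul_of_nonneg_left h2 hm.le
  have h5 : m * (W / (4 * ρ)) = m / (4 * ρ) * W := by ring
  linarith

theorem shell_bound (d : ℕ) (hd : 1 ≤ d) (m β : ℝ) (hm : 0 < m)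
    (hβ : ((d : ℝ) + 1) / 2 < β) : ∃ C : ℝ, 0 < C ∧
    ∀ (e : EuclideanSpace ℝ (Fin d)), ‖e‖ = 1 → ∀ r : ℝ, 1 < r →
    ∫⁻ y in {y : EuclideanSpace ℝ (Fin d) | r < ‖y‖},
      ENNReal.ofReal (Real.exp (-m * (‖y‖ - inner ℝ e y)) * ‖y‖ ^ (-β)) ≤
    ENNReal.ofReal (C * r ^ (((d : ℝ) + 1) / 2 - β)) := by
  obtain ⟨n, rfl⟩ : ∃ n, d = n + 1 := ⟨d - 1, by omega⟩
  set C₀ := Real.exp 1 * (√(4 * Real.pi) * √(4 * Real.pi / m) ^ n) with hC₀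
  have hC₀p : 0 < C₀ := by positivity
  set p := (((n + 1 : ℕ) : ℝ) + 1) / 2 with hp
  have hβ0 : 0 ≤ β := by
    have : 0 ≤ p := by positivity
    linarith
  set q : ℝ := 2 ^ (p - β) with hq
  have hq0 : 0 < q := by positivity
  have hq1 : q < 1 := Real.rpow_lt_one_of_one_lt_of_neg (by norm_num) (by linarith)
  refine ⟨C₀ * (1 - q)⁻¹, mul_pos hC₀p (inv_pos.2 (by linarith)), ?_⟩
  intro e he r hr
  have hr0 : 0 < r := by linarith
  have hsub : {y : EuclideanSpace ℝ (Fin (n+1)) | r < ‖y‖} ⊆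
      ⋃ k : ℕ, {y : EuclideanSpace ℝ (Fin (n+1)) | 2 ^ k * r < ‖y‖ ∧ ‖y‖ ≤ 2 * (2 ^ k * r)} := by
    intro y hy
    simp only [Set.mem_ofPred_eq] at hy
    have hex : ∃ k : ℕ, ‖y‖ ≤ 2 ^ k * r := by
      obtain ⟨k, hk⟩ := pow_unbounded_of_one_lt (‖y‖) (one_lt_two (α := ℝ))
      exact ⟨k, by nlinarith [norm_nonneg y]⟩
    classical
    have h1 := Nat.find_spec hex
    have h0 : Nat.find hex ≠ 0 := by
      intro h
      rw [h] at h1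
      simp at h1
      linarith
    obtain ⟨k, hk⟩ := Nat.exists_eq_succ_of_ne_zero h0
    have h2 := Nat.find_min hex (m := k) (by omega)
    rw [hk] at h1
    refine Set.mem_iUnion.2 ⟨k, not_le.1 h2, ?_⟩
    rw [Nat.succ_eq_add_one, pow_succ] at h1
    linarith
  refine (lintegral_mono_set hsub).trans ((lintegral_iUnion_le _ _).trans ?_)
  have hk : ∀ k : ℕ, ∫⁻ y in {y : EuclideanSpace ℝ (Fin (n+1)) |
        2 ^ k * r < ‖y‖ ∧ ‖y‖ ≤ 2 * (2 ^ k * r)},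
      ENNReal.ofReal (Real.exp (-m * (‖y‖ - inner ℝ e y)) * ‖y‖ ^ (-β)) ≤
      ENNReal.ofReal (C₀ * r ^ (p - β) * q ^ k) := by
    intro k
    have hρ : 0 < 2 ^ k * r := by positivity
    calc _ ≤ ∫⁻ y in {y : EuclideanSpace ℝ (Fin (n+1)) |
            2 ^ k * r < ‖y‖ ∧ ‖y‖ ≤ 2 * (2 ^ k * r)},
          ENNReal.ofReal ((2 ^ k * r) ^ (-β)) *
            ENNReal.ofReal (Real.exp (-m * (‖y‖ - inner ℝ e y))) := by
          refine setLIntegral_mono' ?_ ?_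
          · exact (measurableSet_lt measurable_const measurable_norm).inter
              (measurableSet_le measurable_norm measurable_const)
          · intro y hy
            rw [← ENNReal.ofReal_mul (by positivity), mul_comm]
            apply ENNReal.ofReal_le_ofReal
            apply mul_le_mul_of_nonneg_right _ (Real.exp_pos _).le
            exact Real.rpow_le_rpow_of_nonpos hρ hy.1.le (by linarith)
      _ = ENNReal.ofReal ((2 ^ k * r) ^ (-β)) * ∫⁻ y in {y : EuclideanSpace ℝ (Fin (n+1)) |
            2 ^ k * r < ‖y‖ ∧ ‖y‖ ≤ 2 * (2 ^ k * r)},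
            ENNReal.ofReal (Real.exp (-m * (‖y‖ - inner ℝ e y))) :=
          lintegral_const_mul' _ _ ENNReal.ofReal_ne_top
      _ ≤ ENNReal.ofReal ((2 ^ k * r) ^ (-β)) * ENNReal.ofReal (C₀ * (2 ^ k * r) ^ p) := by
          gcongr
          refine (lintegral_mono_set ?_).trans (gauss_bound n e he m (2 ^ k * r) hm hρ)
          intro y hy
          exact hy.2
      _ = _ := by
          rw [← ENNReal.ofReal_mul (by positivity)]
          congr 1
          rw [hq, ← Real.rpow_natCast (2 ^ (p - β)) k, ← Real.rpow_mul (by norm_num),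
            mul_comm (p - β), Real.rpow_mul (by norm_num), Real.rpow_natCast, mul_assoc C₀,
            mul_comm (r ^ (p - β)), ← Real.mul_rpow (by positivity) hr0.le,
            show p - β = -β + p by ring, Real.rpow_add hρ]
          ring
  refine (ENNReal.tsum_le_tsum hk).trans ?_
  rw [← ENNReal.ofReal_tsum_of_nonneg (fun k => by positivity)
    ((summable_geometric_of_lt_one hq0.le hq1).mul_left _), tsum_mul_left,
    tsum_geometric_of_lt_one hq0.le hq1]
  apply le_of_eq
  congr 1
  ring

theorem ratio_eq (m β X Y Z : ℝ) (hX : 0 < X) :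
    (Real.exp (-m * Z) * Z ^ (-β)) * (Real.exp (-m * Y) * Y ^ (-β)) /
      (Real.exp (-m * X) * X ^ (-β)) =
    Real.exp (-m * (Z + Y - X)) * (Z ^ (-β) * Y ^ (-β) * X ^ β) := by
  have h1 : Real.exp (-m * (Z + Y - X)) =
      Real.exp (-m * Z) * Real.exp (-m * Y) / Real.exp (-m * X) := by
    rw [← Real.exp_add, ← Real.exp_sub]
    congr 1
    ring
  rw [h1, Real.rpow_neg hX.le]
  have := Real.rpow_pos_of_pos hX β
  field_simp

theorem rpow_le_aux (β X Y Z : ℝ) (hβ : 0 ≤ β) (hX : 0 < X) (hY : 0 < Y)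
    (hZ : 0 < Z) (h : X ≤ 2 * Z) : Z ^ (-β) * Y ^ (-β) * X ^ β ≤ 2 ^ β * Y ^ (-β) := by
  have h1 : X ^ β ≤ 2 ^ β * Z ^ β := by
    rw [← Real.mul_rpow (by norm_num) hZ.le]
    exact Real.rpow_le_rpow hX.le h hβ
  have h2 : Z ^ (-β) * Z ^ β = 1 := by
    rw [← Real.rpow_add hZ]; simp
  have h3 : 0 < Y ^ (-β) := by positivity
  have h4 : 0 < Z ^ (-β) := by positivity
  calc Z ^ (-β) * Y ^ (-β) * X ^ β ≤ Z ^ (-β) * Y ^ (-β) * (2 ^ β * Z ^ β) := by gcongr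
    _ = (Z ^ (-β) * Z ^ β) * (2 ^ β * Y ^ (-β)) := by ring
    _ = _ := by rw [h2, one_mul]

theorem upper_real (m β X Y Z s t : ℝ) (hm : 0 < m) (hβ : 0 ≤ β) (hX : 0 < X) (hY : 0 < Y)
    (hZ : 0 < Z) (hst : s + t = X) (hs : s ≤ Y) (ht : t ≤ Z) (htri : X ≤ Y + Z) :
    Real.exp (-m * (Z + Y - X)) * (Z ^ (-β) * Y ^ (-β) * X ^ β) ≤
    2 ^ β * (Real.exp (-m * (Y - s)) * Y ^ (-β) + Real.exp (-m * (Z - t)) * Z ^ (-β)) := by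
  have p1 : 0 ≤ Real.exp (-m * (Y - s)) * Y ^ (-β) := by positivity
  have p2 : 0 ≤ Real.exp (-m * (Z - t)) * Z ^ (-β) := by positivity
  have p3 : (0 : ℝ) ≤ 2 ^ β := by positivity
  rcases le_total Y Z with h | h
  · have h1 := rpow_le_aux β X Y Z hβ hX hY hZ (by linarith)
    have h2 : Real.exp (-m * (Z + Y - X)) ≤ Real.exp (-m * (Y - s)) := by
      apply Real.exp_le_exp.mpr; nlinarith
    calc _ ≤ Real.exp (-m * (Y - s)) * (2 ^ β * Y ^ (-β)) :=
          mul_le_mul h2 h1 (by positivity) (by positivity)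
      _ ≤ _ := by nlinarith [mul_nonneg p3 p2]
  · have h1 := rpow_le_aux β X Z Y hβ hX hZ hY (by linarith)
    have h2 : Real.exp (-m * (Z + Y - X)) ≤ Real.exp (-m * (Z - t)) := by
      apply Real.exp_le_exp.mpr; nlinarith
    calc _ ≤ Real.exp (-m * (Z - t)) * (2 ^ β * Z ^ (-β)) := by
          rw [mul_comm (Z ^ (-β))]
          exact mul_le_mul h2 h1 (by positivity) (by positivity)
      _ ≤ _ := by nlinarith [mul_nonneg p3 p1]

theorem upper_bound (d : ℕ) (hd : 1 ≤ d) (m β : ℝ) (hm : 0 < m)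
    (c₁ c₂ : ℝ) (hc₁ : 0 < c₁) (hc : c₁ ≤ c₂)
    (f : EuclideanSpace ℝ (Fin d) → ℝ)
    (hlo : ∀ x : EuclideanSpace ℝ (Fin d), 1 ≤ ‖x‖ →
      c₁ * (Real.exp (-m * ‖x‖) * ‖x‖ ^ (-β)) ≤ f x)
    (hhi : ∀ x : EuclideanSpace ℝ (Fin d), 1 ≤ ‖x‖ →
      f x ≤ c₂ * (Real.exp (-m * ‖x‖) * ‖x‖ ^ (-β)))
    (hβ : ((d : ℝ) + 1) / 2 < β) : ∃ b : ℝ, 0 < b ∧ ∀ r : ℝ, 1 < r →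
      Kf d f r ≤ ENNReal.ofReal (b * r ^ (((d : ℝ) + 1) / 2 - β)) := by
  obtain ⟨C, hC, hCb⟩ := shell_bound d hd m β hm hβ
  have hβ0 : 0 ≤ β := by
    have : 0 ≤ ((d : ℝ) + 1) / 2 := by positivity
    linarith
  have hc₂ : 0 < c₂ := hc₁.trans_le hc
  set M : ℝ := c₂ * c₂ / c₁ * 2 ^ β with hM
  have hMp : 0 < M := by positivity
  refine ⟨M * (2 * C), by positivity, ?_⟩
  intro r hr
  unfold Kf
  apply iSup_le
  rintro ⟨x, hx⟩
  simp only
  have hx0 : 0 < ‖x‖ := by linarith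
  set e : EuclideanSpace ℝ (Fin d) := ‖x‖⁻¹ • x with he
  have hen : ‖e‖ = 1 := by
    rw [he, norm_smul, norm_inv, norm_norm, inv_mul_cancel₀ hx0.ne']
  have hex : inner ℝ e x = ‖x‖ := by
    rw [he, real_inner_smul_left, real_inner_self_eq_norm_sq]
    field_simp
  set G : EuclideanSpace ℝ (Fin d) → ℝ≥0∞ := fun y =>
    ENNReal.ofReal (Real.exp (-m * (‖y‖ - inner ℝ e y)) * ‖y‖ ^ (-β)) with hG
  have hGm : Measurable G := by
    simp only [hG]
    fun_prop
  have hS : MeasurableSet {y : EuclideanSpace ℝ (Fin d) | r < ‖y‖} :=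
    measurableSet_lt measurable_const measurable_norm
  set G' := Set.indicator {y : EuclideanSpace ℝ (Fin d) | r < ‖y‖} G with hG'
  have hG'm : Measurable G' := hGm.indicator hS
  have hGint : ∫⁻ y, G' y ≤ ENNReal.ofReal (C * r ^ (((d : ℝ) + 1) / 2 - β)) := by
    rw [hG', lintegral_indicator hS]
    exact hCb e hen r hr
  have key : ∀ y ∈ {y : EuclideanSpace ℝ (Fin d) | r < ‖x - y‖ ∧ r < ‖y‖},
      ENNReal.ofReal (f (x - y) * f y / f x) ≤ ENNReal.ofReal M * (G' y + G' (x - y)) := by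
    rintro y ⟨hy1, hy2⟩
    have e1 : G' y = G y := Set.indicator_of_mem (by exact hy2) _
    have e2 : G' (x - y) = G (x - y) := Set.indicator_of_mem (by exact hy1) _
    rw [e1, e2, hG, ← ENNReal.ofReal_add (by positivity) (by positivity),
      ← ENNReal.ofReal_mul hMp.le]
    apply ENNReal.ofReal_le_ofReal
    have hY : 0 < ‖y‖ := by linarith
    have hZ : 0 < ‖x - y‖ := by linarith
    have hsl : ∀ z : EuclideanSpace ℝ (Fin d), inner ℝ e z ≤ ‖z‖ := by
      intro z
      have := real_inner_le_norm e z
      rwa [hen, one_mul] at this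
    have hreal := upper_real m β ‖x‖ ‖y‖ ‖x - y‖ (inner ℝ e y) (inner ℝ e (x - y)) hm hβ0 hx0
      hY hZ (by rw [← inner_add_right, add_sub_cancel, hex]) (hsl _) (hsl _)
      (by have := norm_add_le y (x - y); rwa [add_sub_cancel] at this)
    rw [← ratio_eq m β _ _ _ hx0] at hreal
    have hz1 := hlo (x - y) (by linarith)
    have hz2 := hhi (x - y) (by linarith)
    have hy1' := hlo y (by linarith)
    have hy2' := hhi y (by linarith)
    have hx1' := hlo x hx
    set hz := Real.exp (-m * ‖x - y‖) * ‖x - y‖ ^ (-β) with hhz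
    set hyy := Real.exp (-m * ‖y‖) * ‖y‖ ^ (-β) with hhy
    set hxx := Real.exp (-m * ‖x‖) * ‖x‖ ^ (-β) with hhx
    have p1 : 0 < hz := by positivity
    have p2 : 0 < hyy := by positivity
    have p3 : 0 < hxx := by positivity
    calc f (x - y) * f y / f x ≤ (c₂ * hz) * (c₂ * hyy) / (c₁ * hxx) := by
          have : 0 ≤ f y := le_trans (by positivity) hy1'
          gcongr
      _ = c₂ * c₂ / c₁ * (hz * hyy / hxx) := by field_simp
      _ ≤ c₂ * c₂ / c₁ * _ := mul_le_mul_of_nonneg_left hreal (by positivity)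
      _ = _ := by rw [hM]; ring
  calc _ ≤ ∫⁻ y in {y : EuclideanSpace ℝ (Fin d) | r < ‖x - y‖ ∧ r < ‖y‖},
        ENNReal.ofReal M * (G' y + G' (x - y)) := by
        refine setLIntegral_mono (by fun_prop) key
    _ ≤ ∫⁻ y, ENNReal.ofReal M * (G' y + G' (x - y)) := setLIntegral_le_lintegral _ _
    _ = ENNReal.ofReal M * ((∫⁻ y, G' y) + (∫⁻ y, G' y)) := by
        rw [lintegral_const_mul' _ _ ENNReal.ofReal_ne_top, lintegral_add_left hG'm,
          lintegral_sub_left_eq_self]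
    _ ≤ ENNReal.ofReal M * (ENNReal.ofReal (C * r ^ (((d : ℝ) + 1) / 2 - β)) +
          ENNReal.ofReal (C * r ^ (((d : ℝ) + 1) / 2 - β))) := by gcongr
    _ = _ := by
        rw [← ENNReal.ofReal_add (by positivity) (by positivity), ← ENNReal.ofReal_mul hMp.le]
        congr 1
        ring

/-- The box `ρ < y₀ ≤ 2ρ`, `|yᵢ| ≤ √(ρ/(n+1))`. -/
def lowerBox (n : ℕ) (ρ : ℝ) : Set (EuclideanSpace ℝ (Fin (n+1))) :=
  (WithLp.ofLp : EuclideanSpace ℝ (Fin (n+1)) → (Fin (n+1) → ℝ)) ⁻¹'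
    (Set.univ.pi fun i => Set.Ioc
      ((Fin.cons ρ (fun _ => -√(ρ / (n+1))) : Fin (n+1) → ℝ) i)
      ((Fin.cons (2 * ρ) (fun _ => √(ρ / (n+1))) : Fin (n+1) → ℝ) i))

theorem lowerBox_meas (n : ℕ) (ρ : ℝ) : MeasurableSet (lowerBox n ρ) := by
  unfold lowerBox
  refine (PiLp.volume_preserving_ofLp (Fin (n+1))).measurable ?_
  exact MeasurableSet.univ_pi fun i => measurableSet_Ioc

theorem lowerBox_volume (n : ℕ) (ρ : ℝ) (hρ : 0 < ρ) : volume (lowerBox n ρ) =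
    ENNReal.ofReal ((2 / √((n:ℝ)+1)) ^ n * ρ ^ ((((n + 1 : ℕ) : ℝ) + 1) / 2)) := by
  unfold lowerBox
  rw [(PiLp.volume_preserving_ofLp (Fin (n+1))).measure_preimage
    (MeasurableSet.univ_pi fun i => measurableSet_Ioc).nullMeasurableSet, Real.volume_pi_Ioc,
    Fin.prod_univ_succ]
  simp only [Fin.cons_zero, Fin.cons_succ, Finset.prod_const, Finset.card_univ, Fintype.card_fin]
  have hs : 0 ≤ √(ρ / (n+1)) := Real.sqrt_nonneg _
  rw [← ENNReal.ofReal_pow (by linarith), ← ENNReal.ofReal_mul (by linarith)]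
  congr 1
  have h3 : ρ ^ ((((n + 1 : ℕ) : ℝ) + 1) / 2) = ρ * √ρ ^ n := by
    rw [Real.sqrt_eq_rpow, ← Real.rpow_natCast, ← Real.rpow_mul hρ.le]
    nth_rewrite 2 [← Real.rpow_one ρ]
    rw [← Real.rpow_add hρ]
    congr 1
    push_cast
    ring
  rw [h3, Real.sqrt_div hρ.le,
    show √ρ / √((n:ℝ)+1) - -(√ρ / √((n:ℝ)+1)) = 2 / √((n:ℝ)+1) * √ρ by ring, mul_pow]
  ring

theorem lowerBox_geom (n : ℕ) (ρ L : ℝ) (hρ : 1 < ρ) (hL : 4 * ρ ≤ L)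
    (y : EuclideanSpace ℝ (Fin (n+1))) (hy : y ∈ lowerBox n ρ) :
    ρ < y 0 ∧ y 0 ≤ 2 * ρ ∧
    ρ < ‖EuclideanSpace.single 0 L - y‖ ∧ ρ < ‖y‖ ∧ ‖EuclideanSpace.single 0 L - y‖ ≤ L ∧
    ‖y‖ ≤ 4 * ρ ∧ ‖EuclideanSpace.single 0 L - y‖ + ‖y‖ - L ≤ 1 := by
  have h0 := hy 0 (Set.mem_univ _)
  simp only [Fin.cons_zero, Set.mem_Ioc] at h0
  obtain ⟨h0, h0'⟩ := h0
  have hi : ∀ i : Fin n, (y i.succ) ^ 2 ≤ ρ / (n + 1) := by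
    intro i
    have h := hy i.succ (Set.mem_univ _)
    simp only [Fin.cons_succ, Set.mem_Ioc] at h
    have h2 := abs_le.2 ⟨h.1.le, h.2⟩
    have h3 := Real.sq_sqrt (show 0 ≤ ρ / ((n:ℝ) + 1) by positivity)
    rw [← h3]
    exact sq_le_sq' h.1.le h.2
  have hYY : ‖y‖ ^ 2 = (y 0) ^ 2 + ∑ i : Fin n, (y i.succ) ^ 2 := by
    rw [EuclideanSpace.real_norm_sq_eq, Fin.sum_univ_succ]
  have hZZ : ‖EuclideanSpace.single 0 L - y‖ ^ 2 = (L - y 0) ^ 2 + ∑ i : Fin n, (y i.succ) ^ 2 := by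
    rw [EuclideanSpace.real_norm_sq_eq, Fin.sum_univ_succ]
    simp
  have hW : ∑ i : Fin n, (y i.succ) ^ 2 ≤ ρ := by
    calc _ ≤ ∑ i : Fin n, ρ / ((n:ℝ) + 1) := Finset.sum_le_sum fun i _ => hi i
      _ = n * (ρ / (n + 1)) := by simp
      _ ≤ ρ := by
        rw [mul_div_assoc', div_le_iff₀ (by positivity)]
        nlinarith
  have hW0 : 0 ≤ ∑ i : Fin n, (y i.succ) ^ 2 := by positivity
  set W := ∑ i : Fin n, (y i.succ) ^ 2
  set Y := ‖y‖
  set Z := ‖EuclideanSpace.single 0 L - y‖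
  have hY0 : 0 ≤ Y := norm_nonneg _
  have hZ0 : 0 ≤ Z := norm_nonneg _
  have a1 : Y ≤ y 0 + 1 / 2 := abs_le_of_sq_le_sq' (by nlinarith) (by linarith) |>.2
  have a2 : Z ≤ L - y 0 + 1 / 2 := abs_le_of_sq_le_sq' (by nlinarith) (by linarith) |>.2
  have a3 : y 0 ≤ Y := abs_le_of_sq_le_sq' (by nlinarith) hY0 |>.2
  have a4 : L - y 0 ≤ Z := abs_le_of_sq_le_sq' (by nlinarith) hZ0 |>.2
  refine ⟨h0, h0', ?_, ?_, ?_, ?_, ?_⟩ <;> linarith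

theorem lower_box_int (n : ℕ) (m β : ℝ) (hm : 0 < m) (hβ : 0 ≤ β)
    (c₁ c₂ : ℝ) (hc₁ : 0 < c₁) (hc : c₁ ≤ c₂)
    (f : EuclideanSpace ℝ (Fin (n+1)) → ℝ)
    (hlo : ∀ x : EuclideanSpace ℝ (Fin (n+1)), 1 ≤ ‖x‖ →
      c₁ * (Real.exp (-m * ‖x‖) * ‖x‖ ^ (-β)) ≤ f x)
    (hhi : ∀ x : EuclideanSpace ℝ (Fin (n+1)), 1 ≤ ‖x‖ →
      f x ≤ c₂ * (Real.exp (-m * ‖x‖) * ‖x‖ ^ (-β))) :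
    ∃ c : ℝ, 0 < c ∧ ∀ ρ L : ℝ, 1 < ρ → 4 * ρ ≤ L →
      ENNReal.ofReal (c * ρ ^ ((((n + 1 : ℕ) : ℝ) + 1) / 2 - β)) ≤
      ∫⁻ y in lowerBox n ρ, ENNReal.ofReal
        (f (EuclideanSpace.single 0 L - y) * f y / f (EuclideanSpace.single 0 L)) := by
  have hc₂ : 0 < c₂ := hc₁.trans_le hc
  set M : ℝ := c₁ * c₁ / c₂ * (Real.exp (-m) * 4 ^ (-β)) with hM
  have hMp : 0 < M := by positivity
  refine ⟨M * (2 / √((n:ℝ)+1)) ^ n, by positivity, ?_⟩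
  intro ρ L hρ hL
  have hρ0 : 0 < ρ := by linarith
  have hL0 : 0 < L := by linarith
  have hnx : ‖(EuclideanSpace.single 0 L : EuclideanSpace ℝ (Fin (n+1)))‖ = L := by
    rw [EuclideanSpace.norm_single, Real.norm_of_nonneg hL0.le]
  calc _ = ∫⁻ y in lowerBox n ρ, ENNReal.ofReal (M * ρ ^ (-β)) := by
        rw [setLIntegral_const, lowerBox_volume n ρ hρ0, ← ENNReal.ofReal_mul (by positivity)]
        congr 1
        rw [show ((((n + 1 : ℕ) : ℝ) + 1) / 2 - β) = -β + (((n + 1 : ℕ) : ℝ) + 1) / 2 by ring,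
          Real.rpow_add hρ0]
        ring
    _ ≤ _ := by
        refine setLIntegral_mono' (lowerBox_meas n ρ) ?_
        intro y hy
        apply ENNReal.ofReal_le_ofReal
        obtain ⟨-, -, g1, g2, g3, g4, g5⟩ := lowerBox_geom n ρ L hρ hL y hy
        have hz1 := hlo (EuclideanSpace.single 0 L - y) (by linarith)
        have hy1' := hlo y (by linarith)
        have hx1' := hlo (EuclideanSpace.single 0 L) (by linarith)
        have hx2' := hhi (EuclideanSpace.single 0 L) (by linarith)
        rw [hnx] at hx1' hx2'
        set Z := ‖EuclideanSpace.single 0 L - y‖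
        set Y := ‖y‖
        have hZ0 : 0 < Z := by linarith
        have hY0 : 0 < Y := by linarith
        have hr := ratio_eq m β L Y Z hL0
        set hz := Real.exp (-m * Z) * Z ^ (-β) with hhz
        set hyy := Real.exp (-m * Y) * Y ^ (-β) with hhy
        set hxx := Real.exp (-m * L) * L ^ (-β) with hhx
        have p1 : 0 < hz := by positivity
        have p2 : 0 < hyy := by positivity
        have p3 : 0 < hxx := by positivity
        have hfx : 0 < f (EuclideanSpace.single 0 L) := lt_of_lt_of_le (by positivity) hx1'
        have hfz : 0 < f (EuclideanSpace.single 0 L - y) := lt_of_lt_of_le (by positivity) hz1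
        have q1 : Real.exp (-m) ≤ Real.exp (-m * (Z + Y - L)) := by
          apply Real.exp_le_exp.mpr; nlinarith
        have q2 : 1 ≤ Z ^ (-β) * L ^ β := by
          have : Z ^ β ≤ L ^ β := Real.rpow_le_rpow hZ0.le g3 hβ
          have h2 : Z ^ (-β) * Z ^ β = 1 := by
            rw [← Real.rpow_add hZ0]; simp
          have h4 : 0 < Z ^ (-β) := by positivity
          nlinarith
        have q3 : 4 ^ (-β) * ρ ^ (-β) ≤ Y ^ (-β) := by
          rw [← Real.mul_rpow (by norm_num) hρ0.le]
          exact Real.rpow_le_rpow_of_nonpos hY0 g4 (by linarith)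
        have q4 : Real.exp (-m) * (4 ^ (-β) * ρ ^ (-β)) ≤ hz * hyy / hxx := by
          rw [hr]
          apply mul_le_mul q1 _ (by positivity) (by positivity)
          have h4 : 0 < Y ^ (-β) := by positivity
          calc _ ≤ Y ^ (-β) := q3
            _ ≤ (Z ^ (-β) * L ^ β) * Y ^ (-β) := le_mul_of_one_le_left h4.le q2
            _ = _ := by ring
        calc M * ρ ^ (-β) = c₁ * c₁ / c₂ * (Real.exp (-m) * (4 ^ (-β) * ρ ^ (-β))) := by
              rw [hM]; ring
          _ ≤ c₁ * c₁ / c₂ * (hz * hyy / hxx) := mul_le_mul_of_nonneg_left q4 (by positivity)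
          _ = (c₁ * hz) * (c₁ * hyy) / (c₂ * hxx) := by field_simp
          _ ≤ _ := by
              have hfy : 0 < f y := lt_of_lt_of_le (by positivity) hy1'
              have hnn := (mul_pos hfz hfy).le
              gcongr

theorem lower_bound (n : ℕ) (f : EuclideanSpace ℝ (Fin (n+1)) → ℝ) (c p : ℝ)
    (hc : ∀ ρ L : ℝ, 1 < ρ → 4 * ρ ≤ L →
      ENNReal.ofReal (c * ρ ^ p) ≤
      ∫⁻ y in lowerBox n ρ, ENNReal.ofReal
        (f (EuclideanSpace.single 0 L - y) * f y / f (EuclideanSpace.single 0 L)))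
    (r : ℝ) (hr : 1 < r) (N : ℕ) :
    ∑ k ∈ Finset.range N, ENNReal.ofReal (c * (2 ^ k * r) ^ p) ≤ Kf (n+1) f r := by
  set L : ℝ := 4 * (2 ^ N * r) with hL
  have hN1 : (1:ℝ) ≤ 2 ^ N := one_le_pow₀ (by norm_num)
  have hL1 : 1 ≤ L := by nlinarith
  have hnx : ‖(EuclideanSpace.single 0 L : EuclideanSpace ℝ (Fin (n+1)))‖ = L := by
    rw [EuclideanSpace.norm_single, Real.norm_of_nonneg (by linarith)]
  have hρ : ∀ k : ℕ, r ≤ 2 ^ k * r := fun k => by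
    have : (1:ℝ) ≤ 2 ^ k := one_le_pow₀ (by norm_num)
    nlinarith
  have hLk : ∀ k ∈ Finset.range N, 4 * (2 ^ k * r) ≤ L := fun k hk => by
    have : (2:ℝ) ^ k ≤ 2 ^ N := pow_le_pow_right₀ (by norm_num) (Finset.mem_range.1 hk).le
    rw [hL]
    gcongr
  unfold Kf
  refine le_trans ?_ (le_iSup _ (⟨EuclideanSpace.single 0 L, by rw [hnx]; exact hL1⟩ :
    {x : EuclideanSpace ℝ (Fin (n+1)) // 1 ≤ ‖x‖}))
  simp only
  refine (Finset.sum_le_sum fun k hk => hc (2 ^ k * r) L (hr.trans_le (hρ k)) (hLk k hk)).trans ?_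
  rw [← lintegral_biUnion_finset (t := fun k : ℕ => lowerBox n (2 ^ k * r)) ?_
    (fun k _ => lowerBox_meas n _)]
  · apply lintegral_mono_set
    intro y hy
    simp only [Set.mem_iUnion] at hy
    obtain ⟨k, hk, hy⟩ := hy
    obtain ⟨-, -, g1, g2, -⟩ := lowerBox_geom n _ L (hr.trans_le (hρ k)) (hLk k hk) y hy
    exact ⟨(hρ k).trans_lt g1, (hρ k).trans_lt g2⟩
  · have key : ∀ j k : ℕ, j ∈ Finset.range N → k ∈ Finset.range N → j < k →
        Disjoint (lowerBox n (2 ^ j * r)) (lowerBox n (2 ^ k * r)) := by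
      intro j k hj hk hjk
      rw [Set.disjoint_left]
      intro y hy1 hy2
      obtain ⟨-, g2, -⟩ := lowerBox_geom n _ L (hr.trans_le (hρ j)) (hLk j hj) y hy1
      obtain ⟨g1, -⟩ := lowerBox_geom n _ L (hr.trans_le (hρ k)) (hLk k hk) y hy2
      have : (2:ℝ) ^ (j + 1) ≤ 2 ^ k := pow_le_pow_right₀ (by norm_num) hjk
      rw [pow_succ] at this
      nlinarith
    intro j hj k hk hjk
    rcases lt_or_gt_of_ne hjk with h | h
    · exact key j k hj hk h
    · exact (key k j hk hj h).symm

theorem stmt15 (d : ℕ) (hd : 1 ≤ d) (m β : ℝ) (hm : 0 < m) (hβ : 0 ≤ β)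
    (c₁ c₂ : ℝ) (hc₁ : 0 < c₁) (hc : c₁ ≤ c₂)
    (η : EuclideanSpace ℝ (Fin d) → ℝ)
    (hη : ∀ x : EuclideanSpace ℝ (Fin d), ‖x‖ = 1 → η x ∈ Set.Icc c₁ c₂)
    (f : EuclideanSpace ℝ (Fin d) → ℝ) (hfm : Measurable f)
    (hf : ∀ x : EuclideanSpace ℝ (Fin d), x ≠ 0 →
      f x = η ((1 / ‖x‖) • x) * (Real.exp (-m * ‖x‖) * (max 1 ‖x‖) ^ (-β))) :
    (β ≤ ((d : ℝ) + 1) / 2 → ∀ r : ℝ, 1 < r → Kf d f r = ⊤) ∧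
    (((d : ℝ) + 1) / 2 < β → ∃ a b : ℝ, 0 < a ∧ a ≤ b ∧ ∀ r : ℝ, 1 < r →
      ENNReal.ofReal (a * r ^ (((d : ℝ) + 1) / 2 - β)) ≤ Kf d f r ∧
      Kf d f r ≤ ENNReal.ofReal (b * r ^ (((d : ℝ) + 1) / 2 - β))) := by
  have hbd : ∀ x : EuclideanSpace ℝ (Fin d), 1 ≤ ‖x‖ →
      c₁ * (Real.exp (-m * ‖x‖) * ‖x‖ ^ (-β)) ≤ f x ∧
      f x ≤ c₂ * (Real.exp (-m * ‖x‖) * ‖x‖ ^ (-β)) := by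
    intro x hx
    have hx0 : 0 < ‖x‖ := by linarith
    have h1 : ‖(1 / ‖x‖) • x‖ = 1 := by
      rw [norm_smul, norm_div, norm_one, norm_norm, one_div, inv_mul_cancel₀ hx0.ne']
    obtain ⟨h2, h3⟩ := hη _ h1
    rw [hf x (norm_pos_iff.1 hx0), max_eq_right hx]
    have h4 : 0 ≤ Real.exp (-m * ‖x‖) * ‖x‖ ^ (-β) := by positivity
    exact ⟨mul_le_mul_of_nonneg_right h2 h4, mul_le_mul_of_nonneg_right h3 h4⟩
  have hlo := fun x hx => (hbd x hx).1
  have hhi := fun x hx => (hbd x hx).2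
  have hup := upper_bound d hd m β hm c₁ c₂ hc₁ hc f hlo hhi
  clear hbd hf hη hfm
  obtain ⟨n, rfl⟩ : ∃ n, d = n + 1 := ⟨d - 1, by omega⟩
  obtain ⟨c, hc0, hcb⟩ := lower_box_int n m β hm hβ c₁ c₂ hc₁ hc f hlo hhi
  constructor
  · intro hβ' r hr
    apply ENNReal.eq_top_of_forall_nnreal_le
    intro q
    obtain ⟨N, hN⟩ := exists_nat_ge ((q : ℝ) / c)
    refine le_trans ?_ (lower_bound n f c _ hcb r hr N)
    calc (q : ℝ≥0∞) = ENNReal.ofReal q := (ENNReal.ofReal_coe_nnreal).symm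
      _ ≤ ENNReal.ofReal (N * c) := ENNReal.ofReal_le_ofReal ((div_le_iff₀ hc0).1 hN)
      _ = ∑ k ∈ Finset.range N, ENNReal.ofReal c := by
          rw [Finset.sum_const, Finset.card_range, nsmul_eq_mul,
            ENNReal.ofReal_mul (by positivity), ENNReal.ofReal_natCast]
      _ ≤ _ := by
          refine Finset.sum_le_sum fun k _ => ENNReal.ofReal_le_ofReal ?_
          have h1 : (1:ℝ) ≤ 2 ^ k := one_le_pow₀ (by norm_num)
          exact le_mul_of_one_le_right hc0.le
            (Real.one_le_rpow (by nlinarith) (by linarith))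
  · intro hβ'
    obtain ⟨b, hb0, hb⟩ := hup hβ'
    refine ⟨c, max b c, hc0, le_max_right _ _, fun r hr => ⟨?_, ?_⟩⟩
    · have := lower_bound n f c _ hcb r hr 1
      simpa using this
    · refine (hb r hr).trans (ENNReal.ofReal_le_ofReal ?_)
      have : 0 < r := by linarith
      gcongr
      exact le_max_left _ _
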